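/- For all integers n and k with n ≥ k ≥ 4, the outerplanar Turán number of the path P_k satisfies ex_OP(n, P_k) = max{ 2n − ⌈(n − k + 1)/(⌊k/2⌋ − 1)⌉ − 4 , B(n,k) }, where B(n,k) = 2n − 3⌈n/(k−1)⌉ + 1 if n ≡ 1 (mod k − 1) and B(n,k) = 2n − 3⌈n/(k−1)⌉ otherwise. -/

import Mathlib

/-- A simple graph is outerplanar if it admits a one-page book embedding:
an injective integer labeling of the vertices such that no two edges interleave. -/
def IsOuterplanar {V : Type*} (G : SimpleGraph V) : Prop :=
  ∃ f : V → ℤ, Function.Injective f ∧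
    ∀ a b c d : V, G.Adj a b → G.Adj c d →
      ¬(f a < f c ∧ f c < f b ∧ f b < f d)

/-- `G` contains a subgraph isomorphic to `H`. -/
def ContainsCopy {W V : Type*} (H : SimpleGraph W) (G : SimpleGraph V) : Prop :=
  ∃ φ : H →g G, Function.Injective φ

/-- The outerplanar Turán number: maximum number of edges of an `H`-free
outerplanar graph on `n` vertices. -/
noncomputable def exOP (n : ℕ) {W : Type*} (H : SimpleGraph W) : ℕ :=
  sSup {m : ℕ | ∃ G : SimpleGraph (Fin n),
    IsOuterplanar G ∧ ¬ ContainsCopy H G ∧ m = G.edgeSet.ncard}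

open Classical in
/-- number of edges of `G` inside `S` -/
noncomputable def ec (G : SimpleGraph ℤ) (S : Finset ℤ) : ℕ :=
  ((S ×ˢ S).filter (fun p => p.1 < p.2 ∧ G.Adj p.1 p.2)).card

def NC (G : SimpleGraph ℤ) : Prop :=
  ∀ a b c d : ℤ, G.Adj a b → G.Adj c d → ¬(a < c ∧ c < b ∧ b < d)

def Conn (G : SimpleGraph ℤ) (S : Finset ℤ) : Prop :=
  ∀ T ⊆ S, T.Nonempty → T ≠ S → ∃ a ∈ T, ∃ b ∈ S, b ∉ T ∧ G.Adj a b

def PathIn (G : SimpleGraph ℤ) (S : Finset ℤ) (l : List ℤ) : Prop :=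
  l.IsChain G.Adj ∧ l.Nodup ∧ ∀ x ∈ l, x ∈ S

structure Str (G : SimpleGraph ℤ) (S : Finset ℤ) (w : List ℕ) : Prop where
  sum : w.sum + 1 = S.card
  edges : ec G S + w.length ≤ 2 * w.sum
  start : ∀ u ∈ S, ∀ x ∈ w, ∃ l, PathIn G S (u :: l) ∧ x ≤ l.length
  pair : w.Pairwise (fun x y => ∃ l, PathIn G S l ∧ x + y + 1 ≤ l.length)
  conn : ∀ u ∈ S, ∀ v ∈ S, ∃ l, PathIn G S l ∧ l.head? = some u ∧ l.getLast? = some v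

theorem PathIn.mono {G : SimpleGraph ℤ} {S T : Finset ℤ} (h : S ⊆ T) {l : List ℤ}
    (hl : PathIn G S l) : PathIn G T l :=
  ⟨hl.1, hl.2.1, fun x hx => h (hl.2.2 x hx)⟩

theorem PathIn.rev {G : SimpleGraph ℤ} {S : Finset ℤ} {l : List ℤ}
    (hl : PathIn G S l) : PathIn G S l.reverse := by
  refine ⟨?_, List.nodup_reverse.2 hl.2.1, fun x hx => hl.2.2 x (List.mem_reverse.1 hx)⟩
  rw [List.isChain_reverse]
  exact hl.1.imp (fun a b h => h.symm)

theorem PathIn.glue {G : SimpleGraph ℤ} {A B : Finset ℤ} {c : ℤ} {l₁ l₂ : List ℤ}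
    (hAB : ∀ x ∈ A, x ∈ B → x = c)
    (h1 : PathIn G A (l₁ ++ [c])) (h2 : PathIn G B (c :: l₂)) :
    PathIn G (A ∪ B) (l₁ ++ c :: l₂) := by
  refine ⟨List.isChain_split.2 ⟨h1.1, h2.1⟩, ?_, ?_⟩
  · rw [List.nodup_append]
    have h1n := List.nodup_append.1 h1.2.1
    refine ⟨h1n.1, h2.2.1, ?_⟩
    intro a ha b hb hab
    subst hab
    have := hAB a (h1.2.2 a (by simp [ha])) (h2.2.2 a hb)
    exact h1n.2.2 a ha c (by simp) this
  · intro x hx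
    rw [List.mem_append] at hx
    rcases hx with hx | hx
    · exact Finset.mem_union_left _ (h1.2.2 x (by simp [hx]))
    · exact Finset.mem_union_right _ (h2.2.2 x hx)

theorem Str.glue_half {G : SimpleGraph ℤ} {A B : Finset ℤ} {c : ℤ} {w₁ w₂ : List ℕ}
    (hAB : ∀ x ∈ A, x ∈ B → x = c) (hcA : c ∈ A) (hcB : c ∈ B)
    (h1 : Str G A w₁) (h2 : Str G B w₂) :
    (∀ u ∈ A, ∀ x ∈ w₂, ∃ l, PathIn G (A ∪ B) (u :: l) ∧ x ≤ l.length) ∧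
    (∀ u ∈ A, ∀ v ∈ B, ∃ l, PathIn G (A ∪ B) l ∧ l.head? = some u ∧ l.getLast? = some v) := by
  constructor
  · intro u hu x hx
    obtain ⟨l, hl, hlh, hll⟩ := h1.conn u hu c hcA
    obtain ⟨l2, hl2, hx2⟩ := h2.start c hcB x hx
    rw [List.getLast?_eq_some_iff] at hll
    obtain ⟨l1, rfl⟩ := hll
    have := PathIn.glue hAB hl hl2
    cases l1 with
    | nil =>
      simp at hlh
      subst hlh
      exact ⟨l2, by simpa using this, hx2⟩
    | cons y l1 =>
      simp at hlh
      subst hlh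
      refine ⟨_, by simpa using this, ?_⟩
      simp; omega
  · intro u hu v hv
    obtain ⟨l, hl, hlh, hll⟩ := h1.conn u hu c hcA
    obtain ⟨l2, hl2, hl2h, hl2l⟩ := h2.conn c hcB v hv
    rw [List.getLast?_eq_some_iff] at hll
    obtain ⟨l1, rfl⟩ := hll
    rw [List.head?_eq_some_iff] at hl2h
    obtain ⟨l2', rfl⟩ := hl2h
    have := PathIn.glue hAB hl hl2
    refine ⟨_, this, ?_, ?_⟩
    · cases l1 <;> simpa using hlh
    · rw [List.getLast?_append, hl2l]; simp

theorem ec_union {G : SimpleGraph ℤ} {A B : Finset ℤ}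
    (h : ∀ x ∈ A, ∀ y ∈ B, G.Adj x y → x ∈ B ∨ y ∈ A) :
    ec G (A ∪ B) ≤ ec G A + ec G B := by
  classical
  unfold ec
  refine le_trans (Finset.card_le_card ?_) (Finset.card_union_le _ _)
  rintro ⟨x, y⟩ hp
  simp only [Finset.mem_filter, Finset.mem_product, Finset.mem_union] at hp ⊢
  obtain ⟨⟨hx, hy⟩, hlt, hadj⟩ := hp
  have h1 := fun hx hy => h x hx y hy hadj
  have h2 := fun hy hx => h y hy x hx hadj.symm
  tauto

theorem Str.glue {G : SimpleGraph ℤ} {A B : Finset ℤ} {c : ℤ} {w₁ w₂ : List ℕ}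
    (hAB : ∀ x ∈ A, x ∈ B → x = c) (hcA : c ∈ A) (hcB : c ∈ B)
    (hE : ∀ x ∈ A, ∀ y ∈ B, G.Adj x y → x = c ∨ y = c)
    (h1 : Str G A w₁) (h2 : Str G B w₂) : Str G (A ∪ B) (w₁ ++ w₂) := by
  have hBA : ∀ x ∈ B, x ∈ A → x = c := fun x hB hA => hAB x hA hB
  have g1 := Str.glue_half hAB hcA hcB h1 h2
  have g2 := Str.glue_half hBA hcB hcA h2 h1
  rw [Finset.union_comm B A] at g2
  have sA : A ⊆ A ∪ B := Finset.subset_union_left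
  have sB : B ⊆ A ∪ B := Finset.subset_union_right
  refine ⟨?_, ?_, ?_, ?_, ?_⟩
  · have hI : A ∩ B = {c} := by
      ext x
      simp only [Finset.mem_inter, Finset.mem_singleton]
      constructor
      · rintro ⟨a, b⟩; exact hAB x a b
      · rintro rfl; exact ⟨hcA, hcB⟩
    have := Finset.card_union_add_card_inter A B
    rw [hI, Finset.card_singleton] at this
    have := h1.sum
    have := h2.sum
    simp; omega
  · have := ec_union (G := G) (A := A) (B := B) (by
      intro x hx y hy hxy
      rcases hE x hx y hy hxy with rfl | rfl
      · exact Or.inl hcB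
      · exact Or.inr hcA)
    have := h1.edges
    have := h2.edges
    simp; omega
  · intro u hu x hx
    rw [Finset.mem_union] at hu
    rw [List.mem_append] at hx
    rcases hu with hu | hu <;> rcases hx with hx | hx
    · obtain ⟨l, hl, h⟩ := h1.start u hu x hx; exact ⟨l, hl.mono sA, h⟩
    · exact g1.1 u hu x hx
    · exact g2.1 u hu x hx
    · obtain ⟨l, hl, h⟩ := h2.start u hu x hx; exact ⟨l, hl.mono sB, h⟩
  · rw [List.pairwise_append]
    refine ⟨h1.pair.imp ?_, h2.pair.imp ?_, ?_⟩
    · rintro a b ⟨l, hl, h⟩; exact ⟨l, hl.mono sA, h⟩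
    · rintro a b ⟨l, hl, h⟩; exact ⟨l, hl.mono sB, h⟩
    · intro x hx y hy
      obtain ⟨l, hl, hlx⟩ := h1.start c hcA x hx
      obtain ⟨m, hm, hmy⟩ := h2.start c hcB y hy
      have hr := hl.rev
      rw [List.reverse_cons] at hr
      refine ⟨_, PathIn.glue hAB hr hm, ?_⟩
      simp; omega
  · intro u hu v hv
    rw [Finset.mem_union] at hu hv
    rcases hu with hu | hu <;> rcases hv with hv | hv
    · obtain ⟨l, hl, h⟩ := h1.conn u hu v hv; exact ⟨l, hl.mono sA, h⟩
    · exact g1.2 u hu v hv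
    · exact g2.2 u hu v hv
    · obtain ⟨l, hl, h⟩ := h2.conn u hu v hv; exact ⟨l, hl.mono sB, h⟩

theorem Conn.part {G : SimpleGraph ℤ} {A B : Finset ℤ} {c : ℤ} (hcA : c ∈ A)
    (hE : ∀ x ∈ A, ∀ y ∈ B, G.Adj x y → x = c ∨ y = c)
    (hAB : ∀ x ∈ A, x ∈ B → x = c)
    (h : Conn G (A ∪ B)) : Conn G A := by
  classical
  intro T hT hne hTA
  by_cases hc : c ∈ T
  · obtain ⟨z, hzA, hzT⟩ : ∃ z ∈ A, z ∉ T := by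
      by_contra hcon; push Not at hcon
      exact hTA (Finset.Subset.antisymm hT hcon)
    have hzB : z ∉ B := fun hb => hzT (by rw [hAB z hzA hb]; exact hc)
    obtain ⟨a, ha, b, hb, hbT, hab⟩ := h (T ∪ B)
      (Finset.union_subset_union_left hT) (hne.mono Finset.subset_union_left) (by
        intro heq
        have : z ∈ T ∪ B := by rw [heq]; simp [hzA]
        simp [hzT, hzB] at this)
    simp only [Finset.mem_union, not_or] at ha hb hbT
    have hbA : b ∈ A := by tauto
    rcases ha with ha | ha
    · exact ⟨a, ha, b, hbA, hbT.1, hab⟩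
    · rcases hE b hbA a ha hab.symm with rfl | rfl
      · exact absurd hc hbT.1
      · exact ⟨a, hc, b, hbA, hbT.1, hab⟩
  · obtain ⟨a, ha, b, hb, hbT, hab⟩ := h T (hT.trans Finset.subset_union_left) hne (by
        rintro rfl
        exact hc (by simp [hcA]))
    refine ⟨a, ha, b, ?_, hbT, hab⟩
    rw [Finset.mem_union] at hb
    rcases hb with hb | hb
    · exact hb
    · rcases hE a (hT ha) b hb hab with rfl | rfl
      · exact absurd ha hc
      · exact hcA

/-- outerplanar edge bound -/
theorem ec_le {G : SimpleGraph ℤ} (hG : NC G) {S : Finset ℤ} (hS : 2 ≤ S.card) :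
    ec G S + 3 ≤ 2 * S.card := by
  classical
  have hne : S.Nonempty := Finset.card_pos.1 (by omega)
  set M := S.max' hne with hM
  set m := S.min' hne with hm
  have hmM : m < M := S.min'_lt_max'_of_card (by omega)
  set E := (S ×ˢ S).filter (fun p => p.1 < p.2 ∧ G.Adj p.1 p.2) with hE
  set X := E.filter (fun p => ∀ b ∈ S, G.Adj p.1 b → b ≤ p.2) with hX
  set Y := E.filter (fun p => ¬ ∀ b ∈ S, G.Adj p.1 b → b ≤ p.2) with hY
  have hsum : X.card + Y.card = E.card := Finset.card_filter_add_card_filter_not _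
  have hXc : X.card ≤ (S.erase M).card := by
    refine Finset.card_le_card_of_injOn (fun p => p.1) ?_ ?_
    · rintro ⟨a, b⟩ hp
      simp only [hX, hE, Finset.coe_filter, Finset.mem_filter, Finset.mem_product, Set.mem_ofPred_eq] at hp
      have := S.le_max' b hp.1.1.2
      simp only [Finset.coe_erase, Set.mem_sdiff, Finset.mem_coe, Set.mem_singleton_iff]
      exact ⟨hp.1.1.1, by omega⟩
    · rintro ⟨a, b⟩ hp ⟨a', b'⟩ hq hpq
      simp only [hX, hE, Finset.coe_filter, Finset.mem_filter, Finset.mem_product, Set.mem_ofPred_eq] at hp hq hpq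
      subst hpq
      have h1 := hp.2 b' hq.1.1.2 hq.1.2.2
      have h2 := hq.2 b hp.1.1.2 hp.1.2.2
      have : b = b' := by omega
      rw [this]
  have hYc : Y.card ≤ ((S.erase M).erase m).card := by
    refine Finset.card_le_card_of_injOn (fun p => p.2) ?_ ?_
    · rintro ⟨a, b⟩ hp
      simp only [hY, hE, Finset.coe_filter, Finset.mem_filter, Finset.mem_product, Set.mem_ofPred_eq] at hp
      obtain ⟨⟨⟨haS, hbS⟩, hab, hadj⟩, hn⟩ := hp
      push Not at hn
      obtain ⟨b', hb', hadj', hlt⟩ := hn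
      have := S.le_max' b' hb'
      have := S.min'_le a haS
      simp only [Finset.coe_erase, Set.mem_sdiff, Finset.mem_coe, Set.mem_singleton_iff]
      exact ⟨⟨hbS, by omega⟩, by omega⟩
    · rintro ⟨a, b⟩ hp ⟨a', b'⟩ hq hpq
      simp only [hY, hE, Finset.coe_filter, Finset.mem_filter, Finset.mem_product, Set.mem_ofPred_eq] at hp hq hpq
      subst hpq
      obtain ⟨⟨⟨haS, hbS⟩, hab, hadj⟩, hn⟩ := hp
      obtain ⟨⟨⟨haS', hbS'⟩, hab', hadj'⟩, hn'⟩ := hq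
      push Not at hn hn'
      obtain ⟨b1, hb1, hadj1, hlt1⟩ := hn
      obtain ⟨b2, hb2, hadj2, hlt2⟩ := hn'
      have h1 := hG _ _ _ _ hadj hadj2
      have h2 := hG _ _ _ _ hadj' hadj1
      have : a = a' := by omega
      rw [this]
  have hMS : M ∈ S := S.max'_mem hne
  have hmS : m ∈ S.erase M := by
    rw [Finset.mem_erase]; exact ⟨by omega, S.min'_mem hne⟩
  rw [Finset.card_erase_of_mem hmS, Finset.card_erase_of_mem hMS] at hYc
  rw [Finset.card_erase_of_mem hMS] at hXc
  have : ec G S = E.card := by unfold ec; congr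
  omega

/-- Hamiltonian case -/
theorem Str.ham {G : SimpleGraph ℤ} (hG : NC G) {S : Finset ℤ} (hS : 2 ≤ S.card)
    (hgap : ∀ i ∈ S, ∀ j ∈ S, i < j → (∀ s ∈ S, s ≤ i ∨ j ≤ s) → G.Adj i j)
    (hext : ∀ i ∈ S, ∀ j ∈ S, i < j → (∀ s ∈ S, i ≤ s ∧ s ≤ j) → G.Adj i j) :
    Str G S [S.card - 1] := by
  have key : ∀ u ∈ S, ∃ l, PathIn G S (u :: l) ∧ l.length + 1 = S.card ∧ ∀ v ∈ S, v ∈ u :: l := by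
    intro u hu
    have hsort : (S.sort (· ≤ ·)).SortedLT := S.sortedLT_sort
    have hmem : ∀ x, x ∈ S.sort (· ≤ ·) ↔ x ∈ S := fun x => Finset.mem_sort _
    have hlen : (S.sort (· ≤ ·)).length = S.card := Finset.length_sort _
    generalize S.sort (· ≤ ·) = L at hsort hmem hlen
    have hpw : L.Pairwise (· < ·) := hsort.pairwise
    have hch : L.IsChain G.Adj := by
      rw [List.isChain_iff_getElem]
      intro i hi
      refine hgap _ ((hmem _).1 (List.getElem_mem _)) _ ((hmem _).1 (List.getElem_mem _)) ?_ ?_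
      · exact List.pairwise_iff_getElem.1 hpw _ _ _ _ (by omega)
      · intro s hs
        obtain ⟨j, hj, rfl⟩ := List.getElem_of_mem ((hmem s).2 hs)
        rcases Nat.lt_or_ge i j with h | h
        · right
          rcases Nat.lt_or_ge (i+1) j with h' | h'
          · exact (List.pairwise_iff_getElem.1 hpw _ _ _ _ h').le
          · have : j = i + 1 := by omega
            subst this; exact le_rfl
        · left
          rcases Nat.lt_or_ge j i with h' | h'
          · exact (List.pairwise_iff_getElem.1 hpw _ _ _ _ h').le
          · have : j = i := by omega
            subst this; exact le_rfl
    obtain ⟨s, t, rfl⟩ := List.append_of_mem ((hmem u).2 hu)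
    have hnd : (s ++ u :: t).Nodup := hsort.nodup
    refine ⟨t ++ s, ⟨?_, ?_, ?_⟩, ?_, ?_⟩
    · have hc := List.isChain_append.1 hch
      rw [← List.cons_append, List.isChain_append]
      refine ⟨hc.2.1, hc.1, ?_⟩
      intro x hx y hy
      rw [List.pairwise_append] at hpw
      have hxm := List.mem_of_getLast? hx
      have hym := List.mem_of_mem_head? hy
      refine (hext y ((hmem y).1 (by simp [hym])) x ((hmem x).1 (List.mem_append_right _ hxm))
        (hpw.2.2 y hym x hxm) ?_).symm
      intro z hz
      have hz' := (hmem z).2 hz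
      rw [Option.mem_def, List.head?_eq_some_iff] at hy
      rw [Option.mem_def, List.getLast?_eq_some_iff] at hx
      obtain ⟨s', rfl⟩ := hy
      obtain ⟨t', ht'⟩ := hx
      rw [ht'] at hz' hpw
      have h3 := hpw.2.2
      have h1 := List.pairwise_cons.1 hpw.1
      have h2 := List.pairwise_append.1 hpw.2.1
      have h3y := h3 y (by simp)
      rw [List.mem_append] at hz'
      rcases hz' with hz' | hz'
      · have h4 := h3 z hz' x (by simp)
        rw [List.mem_cons] at hz'
        rcases hz' with rfl | hz'
        · omega
        · have := h1.1 z hz'; omega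
      · have h4 := h3y z hz'
        rw [List.mem_append] at hz'
        rcases hz' with hz' | hz'
        · have := h2.2.2 z hz' x (by simp); omega
        · simp at hz'; omega
    · rw [← List.cons_append]; exact List.nodup_append_comm.1 hnd
    · intro x hx
      exact (hmem x).1 (by simp at hx ⊢; tauto)
    · simp at hlen ⊢; omega
    · intro v hv
      have := (hmem v).2 hv
      simp at this ⊢; tauto
  refine ⟨by simp; omega, ?_, ?_, by simp, ?_⟩
  · have := ec_le hG hS
    simp; omega
  · intro u hu x hx
    obtain ⟨l, hl, hlen, -⟩ := key u hu
    refine ⟨l, hl, ?_⟩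
    simp at hx; omega
  · intro u hu v hv
    obtain ⟨l, hl, hlen, hall⟩ := key u hu
    obtain ⟨s, t, hst⟩ := List.append_of_mem (hall v hv)
    rw [hst] at hl
    refine ⟨s ++ [v], ⟨(List.isChain_split.1 hl.1).1, ?_, ?_⟩, ?_, by simp⟩
    · refine List.Nodup.sublist ?_ hl.2.1
      simp
    · intro x hx
      refine hl.2.2 x ?_
      simp at hx ⊢; tauto
    · cases s with
      | nil => simp at hst ⊢; exact hst.1.symm
      | cons a s => simp at hst ⊢; exact hst.1.symm

def HasCut (G : SimpleGraph ℤ) (S : Finset ℤ) : Prop :=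
  ∃ A B : Finset ℤ, ∃ c, A ∪ B = S ∧ c ∈ A ∧ c ∈ B ∧ 2 ≤ A.card ∧ 2 ≤ B.card ∧
    (∀ x ∈ A, x ∈ B → x = c) ∧ (∀ x ∈ A, ∀ y ∈ B, G.Adj x y → x = c ∨ y = c)

theorem two_le_card {A : Finset ℤ} {a b : ℤ} (ha : a ∈ A) (hb : b ∈ A) (h : a < b) :
    2 ≤ A.card := by
  have : 1 < A.card := Finset.one_lt_card.2 ⟨a, ha, b, hb, by omega⟩
  omega

theorem cut_ext {G : SimpleGraph ℤ} (hG : NC G) {S : Finset ℤ} (hC : Conn G S)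
    {i j : ℤ} (hi : i ∈ S) (hj : j ∈ S) (hij : i < j) (hb : ∀ s ∈ S, i ≤ s ∧ s ≤ j)
    (hadj : ¬ G.Adj i j) : HasCut G S := by
  classical
  obtain ⟨a, ha, b, hbS, hba, hab⟩ := hC {i} (by simpa using hi) (by simp) (by
    intro h
    have : j ∈ ({i} : Finset ℤ) := by rw [h]; exact hj
    simp at this; omega)
  simp at ha hba
  subst ha
  obtain ⟨m, hm, hmax⟩ := (S.filter (fun x => G.Adj a x)).exists_max_image id
    ⟨b, by simp [hbS, hab]⟩
  simp only [Finset.mem_filter, id] at hm hmax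
  have hne : a ≠ m := hm.2.ne
  have hmj : m ≠ j := by rintro rfl; exact hadj hm.2
  have h1 := hb m hm.1
  refine ⟨S.filter (· ≤ m), S.filter (m ≤ ·), m, ?_, ?_, ?_, ?_, ?_, ?_, ?_⟩
  · ext x; simp only [Finset.mem_union, Finset.mem_filter]
    have := le_total x m
    tauto
  · simp [hm.1]
  · simp [hm.1]
  · exact two_le_card (a := a) (b := m) (by simp [hi]; omega) (by simp [hm.1]) (by omega)
  · exact two_le_card (a := m) (b := j) (by simp [hm.1]) (by simp [hj]; omega) (by omega)
  · intro x hx hy; simp at hx hy; omega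
  · intro x hx y hy hxy
    simp at hx hy
    have h2 := hG a m x y hm.2 hxy
    have h3 := hb x hx.1
    by_cases hxa : x = a
    · subst hxa
      have := hmax y ⟨hy.1, hxy⟩
      right; omega
    · omega

theorem cut_gap {G : SimpleGraph ℤ} (hG : NC G) {S : Finset ℤ} (hC : Conn G S)
    {i j : ℤ} (hi : i ∈ S) (hj : j ∈ S) (hij : i < j) (hb : ∀ s ∈ S, s ≤ i ∨ j ≤ s)
    (hadj : ¬ G.Adj i j) : HasCut G S := by
  classical
  obtain ⟨a0, ha0, b0, hb0, hb0', hab0⟩ := hC (S.filter (· ≤ i)) (Finset.filter_subset _ _)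
    ⟨i, by simp [hi]⟩ (by
    intro h
    have : j ∈ S.filter (· ≤ i) := by rw [h]; exact hj
    simp at this; omega)
  simp at ha0 hb0'
  have hb0'' := hb b0 hb0
  obtain ⟨⟨a, b⟩, hm, hmin⟩ := ((S ×ˢ S).filter
    (fun p => p.1 ≤ i ∧ j ≤ p.2 ∧ G.Adj p.1 p.2)).exists_min_image (fun p => p.2 - p.1)
    ⟨(a0, b0), by
      simp only [Finset.mem_filter, Finset.mem_product]
      have := hb0' hb0
      exact ⟨⟨ha0.1, hb0⟩, ha0.2, by omega, hab0⟩⟩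
  simp only [Finset.mem_filter, Finset.mem_product, Prod.forall] at hm hmin
  obtain ⟨⟨haS, hbS⟩, hai, hjb, hab⟩ := hm
  have hne : a < i ∨ j < b := by
    by_contra hcon
    have h1 : a = i := by omega
    have h2 : b = j := by omega
    subst h1 h2; exact hadj hab
  rcases hne with hlt | hlt
  · refine ⟨S.filter (fun x => a ≤ x ∧ x ≤ i), S.filter (fun x => x ≤ a ∨ j ≤ x), a,
      ?_, ?_, ?_, ?_, ?_, ?_, ?_⟩
    · ext x; simp only [Finset.mem_union, Finset.mem_filter]
      constructor
      · tauto
      · intro hx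
        have := hb x hx
        have := le_total x a
        tauto
    · simp [haS]; omega
    · simp [haS]
    · exact two_le_card (a := a) (b := i) (by simp [haS]; omega) (by simp [hi]; omega) hlt
    · exact two_le_card (a := a) (b := j) (by simp [haS]) (by simp [hj]) (by omega)
    · intro x hx hy; simp at hx hy; omega
    · intro x hx y hy hxy
      simp at hx hy
      have h1 := hG y x a b hxy.symm hab
      have h2 := hG a b x y hab hxy
      by_contra hcon
      have h3 : j ≤ y := by omega
      have := hmin x y ⟨⟨hx.1, hy.1⟩, hx.2.2, h3, hxy⟩
      omega
  · refine ⟨S.filter (fun x => j ≤ x ∧ x ≤ b), S.filter (fun x => x ≤ i ∨ b ≤ x), b,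
      ?_, ?_, ?_, ?_, ?_, ?_, ?_⟩
    · ext x; simp only [Finset.mem_union, Finset.mem_filter]
      constructor
      · tauto
      · intro hx
        have := hb x hx
        have := le_total x b
        tauto
    · simp [hbS]; omega
    · simp [hbS]
    · exact two_le_card (a := j) (b := b) (by simp [hj]; omega) (by simp [hbS]; omega) hlt
    · exact two_le_card (a := i) (b := b) (by simp [hi]) (by simp [hbS]) (by omega)
    · intro x hx hy; simp at hx hy; omega
    · intro x hx y hy hxy
      simp at hx hy
      have h1 := hG y x a b hxy.symm hab
      have h2 := hG a b x y hab hxy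
      by_contra hcon
      have h3 : y ≤ i := by
        by_contra h4
        omega
      have := hmin y x ⟨⟨hy.1, hx.1⟩, h3, hx.2.1, hxy.symm⟩
      omega

theorem exists_str {G : SimpleGraph ℤ} (hG : NC G) :
    ∀ N : ℕ, ∀ S : Finset ℤ, S.card ≤ N → 2 ≤ S.card → Conn G S → ∃ w, Str G S w := by
  intro N
  induction N with
  | zero => intro S h1 h2; omega
  | succ N ih =>
    intro S hN hS hC
    by_cases hcut : HasCut G S
    · obtain ⟨A, B, c, rfl, hcA, hcB, h2A, h2B, hAB, hE⟩ := hcut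
      have hI : A ∩ B = {c} := by
        ext x
        simp only [Finset.mem_inter, Finset.mem_singleton]
        constructor
        · rintro ⟨a, b⟩; exact hAB x a b
        · rintro rfl; exact ⟨hcA, hcB⟩
      have hc := Finset.card_union_add_card_inter A B
      rw [hI, Finset.card_singleton] at hc
      obtain ⟨w₁, h1⟩ := ih A (by omega) h2A (Conn.part hcA hE hAB hC)
      obtain ⟨w₂, h2⟩ := ih B (by omega) h2B (Conn.part (B := A) hcB
        (fun x hx y hy hxy => (hE y hy x hx hxy.symm).symm)
        (fun x hx hy => hAB x hy hx) (by rw [Finset.union_comm]; exact hC))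
      exact ⟨_, Str.glue hAB hcA hcB hE h1 h2⟩
    · refine ⟨_, Str.ham hG hS ?_ ?_⟩
      · intro i hi j hj hij hb
        by_contra hadj
        exact hcut (cut_gap hG hC hi hj hij hb hadj)
      · intro i hi j hj hij hb
        by_contra hadj
        exact hcut (cut_ext hG hC hi hj hij hb hadj)

theorem sum_le_of_all (c : ℕ) (l : List ℕ) (h : ∀ x ∈ l, x ≤ c) : l.sum ≤ l.length * c := by
  simpa using List.sum_le_card_nsmul l c h

theorem pair_sum {M : ℕ} (w : List ℕ) (h2 : 2 ≤ w.length)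
    (h : w.Pairwise (fun x y => x + y ≤ M)) : w.sum ≤ M + (w.length - 2) * (M / 2) := by
  by_cases hall : ∀ x ∈ w, x ≤ M / 2
  · have h1 := sum_le_of_all _ _ hall
    obtain ⟨r, hr⟩ : ∃ r, w.length = r + 2 := ⟨w.length - 2, by omega⟩
    rw [hr] at h1 ⊢
    have : (r + 2) * (M / 2) = r * (M / 2) + 2 * (M / 2) := by ring
    have : r + 2 - 2 = r := by omega
    rw [this]
    omega
  · push Not at hall
    obtain ⟨x, hx, hxM⟩ := hall
    have hp : w.Perm (x :: w.erase x) := List.perm_cons_erase hx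
    have h' := (hp.pairwise_iff (fun {a b} (hab : a + b ≤ M) => (by omega : b + a ≤ M))).1 h
    rw [List.pairwise_cons] at h'
    have hlen := hp.length_eq
    have hsum := hp.sum_eq
    rw [hsum, hlen]
    generalize w.erase x = l at *
    cases l with
    | nil => simp at hlen; omega
    | cons y l =>
      have hy := h'.1 y (by simp)
      have := sum_le_of_all (M / 2) l (fun z hz => by
        have := h'.1 z (by simp [hz]); omega)
      simp
      omega

/-- numeric upper-bound predicate -/
def Good (k n E : ℕ) : Prop :=
  (k ≤ n ∧ ∃ c, n + 1 ≤ c * (k / 2 - 1) + k ∧ E + c + 4 ≤ 2 * n) ∨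
  (∃ q, n ≤ q * (k - 1) ∧ E + 3 * q ≤ 2 * n) ∨
  (∃ q, n = q * (k - 1) + 1 ∧ E + 3 * (q + 1) ≤ 2 * n + 1)

theorem Good.add {k a b E F : ℕ} (hk : 4 ≤ k) (h1 : Good k a E) (h2 : Good k b F) :
    Good k (a + b) (E + F) := by
  have h5 : k = 5 → ∀ n E, Good k n E → (∃ q, n ≤ q * (k - 1) ∧ E + 3 * q ≤ 2 * n) ∨
      (∃ q, n = q * (k - 1) + 1 ∧ E + 3 * (q + 1) ≤ 2 * n + 1) := by
    rintro rfl n E (⟨hn, c, h, h'⟩ | h)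
    · norm_num at h
      by_cases h5 : n = 5
      · right; exact ⟨1, by omega, by omega⟩
      · left; exact ⟨(n + 3) / 4, by omega, by omega⟩
    · exact h
  have bb : ∀ {a b E F : ℕ}, ((∃ q, a ≤ q * (k - 1) ∧ E + 3 * q ≤ 2 * a) ∨
      (∃ q, a = q * (k - 1) + 1 ∧ E + 3 * (q + 1) ≤ 2 * a + 1)) →
      ((∃ q, b ≤ q * (k - 1) ∧ F + 3 * q ≤ 2 * b) ∨
      (∃ q, b = q * (k - 1) + 1 ∧ F + 3 * (q + 1) ≤ 2 * b + 1)) →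
      Good k (a + b) (E + F) := by
    intro a b E F h1 h2
    right
    rcases h1 with ⟨p, hp, hp'⟩ | ⟨p, hp, hp'⟩ <;> rcases h2 with ⟨q, hq, hq'⟩ | ⟨q, hq, hq'⟩
    · left; exact ⟨p + q, by rw [add_mul]; omega, by omega⟩
    · by_cases h : a + b = (p + q) * (k - 1) + 1
      · right; exact ⟨p + q, h, by omega⟩
      · left; refine ⟨p + q, ?_, by omega⟩
        rw [add_mul] at *; omega
    · by_cases h : a + b = (p + q) * (k - 1) + 1
      · right; exact ⟨p + q, h, by omega⟩
      · left; refine ⟨p + q, ?_, by omega⟩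
        rw [add_mul] at *; omega
    · left; exact ⟨p + q + 1, by rw [add_mul, add_mul]; omega, by omega⟩
  by_cases hk5 : k = 5
  · exact bb (h5 hk5 _ _ h1) (h5 hk5 _ _ h2)
  have lb : ∀ {a b E F : ℕ}, (k ≤ a ∧ ∃ c, a + 1 ≤ c * (k / 2 - 1) + k ∧ E + c + 4 ≤ 2 * a) →
      ((∃ q, b ≤ q * (k - 1) ∧ F + 3 * q ≤ 2 * b) ∨
      (∃ q, b = q * (k - 1) + 1 ∧ F + 3 * (q + 1) ≤ 2 * b + 1)) →
      Good k (a + b) (E + F) := by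
    rintro a b E F ⟨ha, c, hc, hE⟩ h2
    left
    have h3 : k - 1 ≤ 3 * (k / 2 - 1) := by omega
    rcases h2 with ⟨q, hq, hq'⟩ | ⟨q, hq, hq'⟩
    · refine ⟨by omega, c + 3 * q, ?_, by omega⟩
      have := Nat.mul_le_mul_left q h3
      have : (c + 3 * q) * (k / 2 - 1) = c * (k / 2 - 1) + q * (3 * (k / 2 - 1)) := by ring
      omega
    · refine ⟨by omega, c + 3 * q + 1, ?_, by omega⟩
      have := Nat.mul_le_mul_left q h3
      have : (c + 3 * q + 1) * (k / 2 - 1) =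
        c * (k / 2 - 1) + q * (3 * (k / 2 - 1)) + (k / 2 - 1) := by ring
      omega
  rcases h1 with h1 | h1 <;> rcases h2 with h2 | h2
  · obtain ⟨ha, c, hc, hE⟩ := h1
    obtain ⟨hb, d, hd, hF⟩ := h2
    left
    refine ⟨by omega, c + d + 4, ?_, by omega⟩
    have : (c + d + 4) * (k / 2 - 1) = c * (k / 2 - 1) + d * (k / 2 - 1) + 4 * (k / 2 - 1) := by ring
    omega
  · exact lb h1 h2
  · rw [add_comm a, add_comm E]; exact lb h2 h1
  · exact bb h1 h2

theorem good_of_conn {G : SimpleGraph ℤ} (hG : NC G) {k : ℕ} (hk : 4 ≤ k) {S : Finset ℤ}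
    (hS : 2 ≤ S.card) (hfree : ∀ l, PathIn G S l → l.length < k) (hC : Conn G S) :
    Good k S.card (ec G S) := by
  rcases Nat.lt_or_ge S.card k with hlt | hge
  · right; left
    have := ec_le hG hS
    exact ⟨1, by omega, by omega⟩
  · left
    refine ⟨hge, ?_⟩
    obtain ⟨w, hw⟩ := exists_str hG _ S le_rfl hS hC
    have hsum := hw.sum
    have hlen : 2 ≤ w.length := by
      match w, hw, hsum with
      | [], _, hsum => simp at hsum; omega
      | [x], hw, hsum =>
        obtain ⟨u, hu⟩ : S.Nonempty := Finset.card_pos.1 (by omega)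
        obtain ⟨l, hl, hx⟩ := hw.start u hu x (by simp)
        have := hfree _ hl
        simp at this hsum
        omega
      | x :: y :: l, _, _ => simp
    have hp := pair_sum (M := k - 2) w hlen (hw.pair.imp (by
      rintro x y ⟨l, hl, hxy⟩
      have := hfree _ hl
      omega))
    have he := hw.edges
    have : (k - 2) / 2 = k / 2 - 1 := by omega
    rw [this] at hp
    exact ⟨w.length - 2, by omega, by omega⟩

theorem good_main {G : SimpleGraph ℤ} (hG : NC G) {k : ℕ} (hk : 4 ≤ k) :
    ∀ N : ℕ, ∀ S : Finset ℤ, S.card ≤ N → (∀ l, PathIn G S l → l.length < k) →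
    Good k S.card (ec G S) := by
  classical
  intro N
  induction N with
  | zero =>
    intro S hS _
    have : S = ∅ := Finset.card_eq_zero.1 (by omega)
    subst this
    right; left; exact ⟨0, by simp, by simp [ec]⟩
  | succ N ih =>
    intro S hS hfree
    by_cases h0 : S.card = 0
    · exact ih S (by omega) hfree
    by_cases h1 : S.card = 1
    · obtain ⟨a, rfl⟩ := Finset.card_eq_one.1 h1
      right; right
      refine ⟨0, by simp, ?_⟩
      have : ec G {a} = 0 := by
        unfold ec
        rw [Finset.card_eq_zero, Finset.filter_eq_empty_iff]
        rintro ⟨x, y⟩ h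
        simp at h
        simp [h.1, h.2]
      simp [this]
    by_cases hC : Conn G S
    · exact good_of_conn hG hk (by omega) hfree hC
    · unfold Conn at hC
      push Not at hC
      obtain ⟨T, hTS, hne, hTne, hno⟩ := hC
      have hlt : T.card < S.card := Finset.card_lt_card (lt_of_le_of_ne hTS hTne)
      have hpos := Finset.card_pos.2 hne
      have hsd := Finset.card_sdiff_add_card_eq_card hTS
      have g1 := ih T (by omega) (fun l hl => hfree l (hl.mono hTS))
      have g2 := ih (S \ T) (by omega) (fun l hl => hfree l (hl.mono Finset.sdiff_subset))
      have g := Good.add hk g1 g2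
      have hec := ec_union (G := G) (A := T) (B := S \ T) (by
        intro x hx y hy hxy
        rw [Finset.mem_sdiff] at hy
        exact absurd hxy (hno x hx y hy.1 hy.2))
      rw [Finset.union_sdiff_of_subset hTS] at hec
      have hcard : T.card + (S \ T).card = S.card := by omega
      rw [hcard] at g
      rcases g with ⟨h, c, h1, h2⟩ | ⟨q, h1, h2⟩ | ⟨q, h1, h2⟩
      · left; exact ⟨h, c, h1, by omega⟩
      · right; left; exact ⟨q, h1, by omega⟩
      · right; right; exact ⟨q, h1, by omega⟩

open Classical in
theorem edge_card {V : Type*} [Fintype V] (G : SimpleGraph V) (f : V → ℤ)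
    (hf : Function.Injective f) : G.edgeSet.ncard =
    ((Finset.univ : Finset (V × V)).filter (fun p => f p.1 < f p.2 ∧ G.Adj p.1 p.2)).card := by
  rw [← Set.ncard_coe_finset]
  symm
  refine Set.ncard_congr (fun p _ => s(p.1, p.2)) ?_ ?_ ?_
  · rintro ⟨a, b⟩ h
    simp at h
    simpa using h.2
  · rintro ⟨a, b⟩ ⟨c, d⟩ h1 h2 h
    simp at h1 h2 h
    rcases h with ⟨rfl, rfl⟩ | ⟨rfl, rfl⟩
    · rfl
    · omega
  · intro e he
    induction e using Sym2.ind with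
    | _ a b =>
      rw [SimpleGraph.mem_edgeSet] at he
      have hne : f a ≠ f b := fun h => he.ne (hf h)
      rcases lt_or_gt_of_ne hne with h | h
      · exact ⟨(a, b), by simp [h, he], rfl⟩
      · exact ⟨(b, a), by simp [h, he.symm], Sym2.eq_swap⟩

theorem good_upper {n k : ℕ} (hk : 4 ≤ k) (G : SimpleGraph (Fin n))
    (hO : IsOuterplanar G) (hfree : ¬ ContainsCopy (SimpleGraph.pathGraph k) G) :
    Good k n G.edgeSet.ncard := by
  classical
  obtain ⟨f, hf, hcr⟩ := hO
  set G' : SimpleGraph ℤ := G.map (⟨f, hf⟩ : Fin n ↪ ℤ) with hG'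
  have hadj : ∀ x y, G'.Adj x y ↔ ∃ a b, G.Adj a b ∧ f a = x ∧ f b = y := by
    intro x y; exact SimpleGraph.map_adj (⟨f, hf⟩ : Fin n ↪ ℤ) G x y
  have hNC : NC G' := by
    intro a b c d h1 h2
    obtain ⟨a', b', e1, rfl, rfl⟩ := (hadj _ _).1 h1
    obtain ⟨c', d', e2, rfl, rfl⟩ := (hadj _ _).1 h2
    exact hcr _ _ _ _ e1 e2
  set S : Finset ℤ := Finset.univ.image f with hS
  have hcard : S.card = n := by
    rw [hS, Finset.card_image_of_injective _ hf]; simp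
  have hec : G.edgeSet.ncard ≤ ec G' S := by
    rw [edge_card G f hf]
    unfold ec
    refine Finset.card_le_card_of_injOn (fun p => (f p.1, f p.2)) ?_ ?_
    · rintro ⟨a, b⟩ h
      simp at h
      simp only [Finset.coe_filter, Finset.mem_product, Set.mem_ofPred_eq]
      exact ⟨⟨by simp [hS], by simp [hS]⟩, h.1, (hadj _ _).2 ⟨a, b, h.2, rfl, rfl⟩⟩
    · rintro ⟨a, b⟩ _ ⟨c, d⟩ _ h
      simp at h
      rw [hf h.1, hf h.2]
  have hP : ∀ l, PathIn G' S l → l.length < k := by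
    intro l hl
    by_contra hlen
    push Not at hlen
    apply hfree
    have hg : ∀ i : Fin k, ∃ a : Fin n, f a = l[i.1]'(by omega) := by
      intro i
      have := hl.2.2 _ (List.getElem_mem (l := l) (n := i.1) (by omega))
      simpa [hS] using this
    choose g hg using hg
    have hstep : ∀ i j : Fin k, i.1 + 1 = j.1 → G.Adj (g i) (g j) := by
      intro i j hij
      have h1 := List.isChain_iff_getElem.1 hl.1 i.1 (by omega)
      obtain ⟨a, b, hab, ha, hb⟩ := (hadj _ _).1 h1
      have ha' : a = g i := hf (by rw [hg, ha])
      have hb' : b = g j := hf (by rw [hg, hb]; congr 1)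
      rw [← ha', ← hb']; exact hab
    refine ⟨⟨g, ?_⟩, ?_⟩
    · intro i j hij
      rw [SimpleGraph.pathGraph_adj] at hij
      rcases hij with h | h
      · exact hstep i j h
      · exact (hstep j i h).symm
    · intro i j hij
      have hij' : g i = g j := hij
      have h2 : l[i.1]'(by omega) = l[j.1]'(by omega) := by rw [← hg, ← hg, hij']
      exact Fin.ext ((hl.2.1.getElem_inj_iff).1 h2)
  have g := good_main hNC hk _ S le_rfl hP
  rw [hcard] at g
  rcases g with ⟨h, c, h1, h2⟩ | ⟨q, h1, h2⟩ | ⟨q, h1, h2⟩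
  · left; exact ⟨h, c, h1, by omega⟩
  · right; left; exact ⟨q, h1, by omega⟩
  · right; right; exact ⟨q, h1, by omega⟩

/-- graph on `Fin n` from a relation on pairs `a < b` -/
def mkG (R : ℕ → ℕ → Prop) (n : ℕ) : SimpleGraph (Fin n) where
  Adj a b := (a.1 < b.1 ∧ R a b) ∨ (b.1 < a.1 ∧ R b a)
  symm := ⟨fun a b h => h.symm⟩
  loopless := ⟨fun a h => by omega⟩

open Classical in
noncomputable def cnt (R : ℕ → ℕ → Prop) (n : ℕ) : ℕ :=
  ∑ b ∈ Finset.range n, ((Finset.range b).filter (fun a => R a b)).card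

theorem mkG_card (R : ℕ → ℕ → Prop) (n : ℕ) : cnt R n ≤ (mkG R n).edgeSet.ncard := by
  classical
  rw [edge_card (mkG R n) (fun i => (i.1 : ℤ)) (fun a b h => by simpa [Fin.ext_iff] using h)]
  unfold cnt
  rw [← Finset.card_sigma]
  rw [← Finset.card_attach]
  refine Finset.card_le_card_of_injOn (fun p => (⟨p.1.2, ?_⟩, ⟨p.1.1, ?_⟩)) ?_ ?_
  · have := Finset.mem_sigma.1 p.2
    simp only [Finset.mem_filter, Finset.mem_range] at this; omega
  · have := Finset.mem_sigma.1 p.2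
    simp only [Finset.mem_filter, Finset.mem_range] at this; omega
  · rintro ⟨⟨b, a⟩, h⟩ _
    simp at h
    simp [mkG]
    exact ⟨h.2.1, Or.inl ⟨h.2.1, h.2.2⟩⟩
  · rintro ⟨⟨b, a⟩, h⟩ _ ⟨⟨d, c⟩, h'⟩ _ heq
    simp at heq
    simp [heq.1, heq.2]

theorem mkG_outer (R : ℕ → ℕ → Prop) (n : ℕ)
    (h : ∀ a b c d, R a b → R c d → ¬ (a < c ∧ c < b ∧ b < d)) : IsOuterplanar (mkG R n) := by
  refine ⟨fun i => (i.1 : ℤ), fun a b h => by simpa [Fin.ext_iff] using h, ?_⟩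
  intro a b c d h1 h2
  simp only [mkG] at h1 h2
  rintro ⟨h3, h4, h5⟩
  have := h a b c d
  simp only [Nat.cast_lt] at h3 h4 h5
  have h1' : R a b := by rcases h1 with h1 | h1; exact h1.2; omega
  have h2' : R c d := by rcases h2 with h2 | h2; exact h2.2; omega
  exact this h1' h2' ⟨h3, h4, h5⟩

theorem copy_seq {R : ℕ → ℕ → Prop} {n k : ℕ}
    (h : ContainsCopy (SimpleGraph.pathGraph k) (mkG R n)) :
    ∃ u : ℕ → ℕ, (∀ i < k, ∀ j < k, u i = u j → i = j) ∧
      ∀ i, i + 1 < k → (u i < u (i+1) ∧ R (u i) (u (i+1))) ∨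
        (u (i+1) < u i ∧ R (u (i+1)) (u i)) := by
  obtain ⟨φ, hφ⟩ := h
  refine ⟨fun i => if h : i < k then (φ ⟨i, h⟩).1 else 0, ?_, ?_⟩
  · intro i hi j hj hij
    simp only [hi, hj, dif_pos] at hij
    have := hφ (Fin.ext hij)
    simpa using this
  · intro i hi
    have hi' : i < k := by omega
    simp only [hi, hi', dif_pos]
    exact φ.map_adj (v := ⟨i, hi'⟩) (w := ⟨i+1, hi⟩)
      (by rw [SimpleGraph.pathGraph_adj]; left; rfl)

theorem const_of_step (g : ℕ → ℕ) (a b : ℕ) (hab : a ≤ b)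
    (h : ∀ i, a ≤ i → i < b → g i = g (i+1)) : g a = g b := by
  induction b, hab using Nat.le_induction with
  | base => rfl
  | succ b hb ih =>
    rw [ih (fun i h1 h2 => h i h1 (by omega))]
    exact h b hb (by omega)

theorem card_of_seq {u : ℕ → ℕ} {k : ℕ} (hu : ∀ i < k, ∀ j < k, u i = u j → i = j)
    (T : Finset ℕ) (hT : ∀ i < k, u i ∈ T) : k ≤ T.card := by
  have := Finset.card_le_card_of_injOn (s := Finset.range k) (t := T) u
    (fun i hi => hT i (by simpa using hi))
    (fun i hi j hj h => hu i (by simpa using hi) j (by simpa using hj) h)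
  simpa using this

/-- disjoint fans on `p` vertices -/
def R2 (p a b : ℕ) : Prop := a / p = b / p ∧ (b = a + 1 ∨ a % p = 0)

theorem R2_outer (p a b c d : ℕ) (hp : 0 < p) (h1 : R2 p a b) (h2 : R2 p c d) :
    ¬ (a < c ∧ c < b ∧ b < d) := by
  rintro ⟨h3, h4, h5⟩
  obtain ⟨h1, h1'⟩ := h1
  obtain ⟨h2, h2'⟩ := h2
  have hc : c % p = 0 := by omega
  have ha : a % p = 0 := by omega
  have hac : a / p ≤ c / p := Nat.div_le_div_right h3.le
  have hcb : c / p ≤ b / p := Nat.div_le_div_right h4.le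
  have e1 := Nat.div_add_mod a p
  have e2 := Nat.div_add_mod c p
  have : a / p = c / p := by omega
  rw [this] at e1
  omega

theorem R2_free (p n k : ℕ) (hp : 0 < p) (hk : k = p + 1) :
    ¬ ContainsCopy (SimpleGraph.pathGraph k) (mkG (R2 p) n) := by
  intro h
  obtain ⟨u, hu, hs⟩ := copy_seq h
  have hc : ∀ i < k, u i / p = u 0 / p := by
    intro i hi
    refine (const_of_step (fun i => u i / p) 0 i (by omega) ?_).symm
    intro j _ hj
    rcases hs j (by omega) with h | h
    · exact h.2.1
    · exact h.2.1.symm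
  have := card_of_seq hu (Finset.Ico (p * (u 0 / p)) (p * (u 0 / p) + p)) (by
    intro i hi
    have h1 := hc i hi
    have h2 := Nat.div_add_mod (u i) p
    have h3 := Nat.mod_lt (u i) hp
    rw [h1] at h2
    rw [Finset.mem_Ico]; omega)
  simp at this
  omega

theorem R2_cnt (p n : ℕ) (hp : 3 ≤ p) :
    2 * n ≤ cnt (R2 p) n + 2 * ((n + p - 1) / p) + (n + p - 2) / p := by
  classical
  induction n with
  | zero => simp
  | succ n ih =>
    have hc : cnt (R2 p) (n+1) = cnt (R2 p) n +
      ((Finset.range n).filter (fun a => R2 p a n)).card := by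
      unfold cnt; rw [Finset.sum_range_succ]
    have e1 : (n + 1 + p - 1) / p = (n + p - 1) / p + if n % p = 0 then 1 else 0 := by
      have h1 : n + 1 + p - 1 = (n + p - 1) + 1 := by omega
      rw [h1, Nat.succ_div]
      congr 1
      have : n + p - 1 + 1 = n + p := by omega
      simp only [this, Nat.dvd_iff_mod_eq_zero, Nat.add_mod_right]
    have e2 : n % p = 1 → (n + 1 + p - 2) / p = (n + p - 2) / p + 1 := by
      intro h
      have h1 : n + 1 + p - 2 = (n + p - 2) + 1 := by omega
      rw [h1, Nat.succ_div, if_pos]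
      have e := Nat.div_add_mod n p
      refine ⟨n / p + 1, ?_⟩
      rw [mul_add]; omega
    have e3 : (n + p - 2) / p ≤ (n + 1 + p - 2) / p := Nat.div_le_div_right (by omega)
    have hdm := Nat.div_add_mod n p
    have hml := Nat.mod_lt n (show 0 < p by omega)
    by_cases h0 : n % p = 0
    · rw [if_pos h0] at e1; omega
    · rw [if_neg h0] at e1
      have hpred : R2 p (n - 1) n := by
        refine ⟨?_, Or.inl (by omega)⟩
        refine Nat.div_eq_of_lt_le ?_ ?_
        · rw [mul_comm]; omega
        · rw [mul_comm, mul_add]; omega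
      by_cases h1 : n % p = 1
      · have := e2 h1
        have : 0 < ((Finset.range n).filter (fun a => R2 p a n)).card :=
          Finset.card_pos.2 ⟨n - 1, by simp only [Finset.mem_filter, Finset.mem_range]; exact ⟨by omega, hpred⟩⟩
        omega
      · have hhub : R2 p (p * (n / p)) n := by
          refine ⟨?_, Or.inr (by simp)⟩
          rw [Nat.mul_div_cancel_left _ (by omega)]
        have : 1 < ((Finset.range n).filter (fun a => R2 p a n)).card :=
          Finset.one_lt_card.2 ⟨n - 1, by
            simp only [Finset.mem_filter, Finset.mem_range]; exact ⟨by omega, hpred⟩,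
            p * (n / p), by
            simp only [Finset.mem_filter, Finset.mem_range]; exact ⟨by omega, hhub⟩, by omega⟩
        omega

/-- one hub with path blocks -/
def R1 (t δ a b : ℕ) : Prop := a = 0 ∨ (b = a + 1 ∧ (a - 1 - δ) / t = (b - 1 - δ) / t)

theorem R1_outer (t δ a b c d : ℕ) (h1 : R1 t δ a b) (h2 : R1 t δ c d) :
    ¬ (a < c ∧ c < b ∧ b < d) := by
  rintro ⟨h3, h4, h5⟩
  rcases h2 with h2 | h2 <;> omega

def blk (t δ β : ℕ) : Finset ℕ :=
  if β = 0 then Finset.Icc 1 (t + δ) else Finset.Icc (t * β + 1 + δ) (t * β + t + δ)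

theorem mem_blk {t δ i : ℕ} (ht : 0 < t) (hi : i ≠ 0) : i ∈ blk t δ ((i - 1 - δ) / t) := by
  have e := Nat.div_add_mod (i - 1 - δ) t
  have hm := Nat.mod_lt (i - 1 - δ) ht
  unfold blk
  split_ifs with h
  · rw [h] at e
    simp at e
    rw [Finset.mem_Icc]; omega
  · rw [Finset.mem_Icc]
    have : i - 1 - δ ≠ 0 := by
      intro h0; rw [h0] at h; simp at h
    omega

theorem blk_union (t δ β γ : ℕ) : (blk t δ β ∪ blk t δ γ).card ≤ 2 * t + δ := by
  by_cases h : β = γ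
  · subst h
    rw [Finset.union_self]
    unfold blk
    split_ifs <;> simp <;> omega
  · refine (Finset.card_union_le _ _).trans ?_
    unfold blk
    split_ifs <;> simp <;> omega

theorem R1_free (t δ n k : ℕ) (ht : 0 < t) (hk : k = 2 * t + δ + 2) :
    ¬ ContainsCopy (SimpleGraph.pathGraph k) (mkG (R1 t δ) n) := by
  intro h
  obtain ⟨u, hu, hs⟩ := copy_seq h
  set g : ℕ → ℕ := fun i => (u i - 1 - δ) / t with hg
  have step : ∀ i, i + 1 < k → u i ≠ 0 → u (i+1) ≠ 0 → g i = g (i+1) := by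
    intro i hi h0 h1
    rcases hs i hi with ⟨_, h | h⟩ | ⟨_, h | h⟩
    · exact absurd h h0
    · exact h.2
    · exact absurd h h1
    · exact h.2.symm
  have hmem : ∀ i < k, u i ∈ insert 0 (blk t δ (g 0) ∪ blk t δ (g (k-1))) := by
    intro i hi
    by_cases h0 : u i = 0
    · simp [h0]
    have hb := mem_blk (δ := δ) ht h0
    change u i ∈ blk t δ (g i) at hb
    by_cases hz : ∃ z, z < i ∧ u z = 0
    · obtain ⟨z, hz, hz0⟩ := hz
      have : g i = g (k-1) := by
        refine const_of_step g i (k-1) (by omega) ?_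
        intro j hj hjk
        refine step j (by omega) ?_ ?_
        · intro h; have := hu j (by omega) z (by omega) (by omega); omega
        · intro h; have := hu (j+1) (by omega) z (by omega) (by omega); omega
      rw [this] at hb
      simp [hb]
    · push Not at hz
      have : g 0 = g i := by
        refine const_of_step g 0 i (by omega) ?_
        intro j hj hji
        refine step j (by omega) (hz j hji) ?_
        by_cases h : j + 1 = i
        · rw [h]; exact h0
        · exact hz _ (by omega)
      rw [← this] at hb
      simp [hb]
  have h1 := card_of_seq hu _ hmem
  have h2 := Finset.card_insert_le 0 (blk t δ (g 0) ∪ blk t δ (g (k-1)))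
  have h3 := blk_union t δ (g 0) (g (k-1))
  omega

theorem R1_cnt (t δ n : ℕ) (hn : 2 ≤ n) :
    2 * n ≤ cnt (R1 t δ) n + (n - 1 - 1 - δ) / t + 3 := by
  classical
  have hc : ∀ n, cnt (R1 t δ) (n+1) = cnt (R1 t δ) n +
      ((Finset.range n).filter (fun a => R1 t δ a n)).card := by
    intro n; unfold cnt; rw [Finset.sum_range_succ]
  have hub : ∀ n, 1 ≤ n → 0 ∈ (Finset.range n).filter (fun a => R1 t δ a n) := by
    intro n hn
    simp only [Finset.mem_filter, Finset.mem_range]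
    exact ⟨by omega, Or.inl rfl⟩
  induction n, hn using Nat.le_induction with
  | base =>
    have h1 : cnt (R1 t δ) 2 = _ := hc 1
    have := Finset.card_pos.2 ⟨0, hub 1 le_rfl⟩
    generalize (2 - 1 - 1 - δ) / t = z
    omega
  | succ n hn ih =>
    have h1 := hc n
    have h2 := Finset.card_pos.2 ⟨0, hub n (by omega)⟩
    have h3 : (n - 1 - 1 - δ) / t ≤ (n + 1 - 1 - 1 - δ) / t := Nat.div_le_div_right (by omega)
    by_cases h : (n - 1 - 1 - δ) / t = (n + 1 - 1 - 1 - δ) / t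
    · have : 1 < ((Finset.range n).filter (fun a => R1 t δ a n)).card :=
        Finset.one_lt_card.2 ⟨0, hub n (by omega), n - 1, by
          simp only [Finset.mem_filter, Finset.mem_range]
          exact ⟨by omega, Or.inr ⟨by omega, by simpa using h⟩⟩, by omega⟩
      omega
    · omega

theorem ceil_facts (n k : ℕ) (hk : 4 ≤ k) (hn : k ≤ n) :
    ∃ C D : ℕ, ⌈((n : ℚ) - (k : ℚ) + 1) / (((k / 2 : ℕ) : ℚ) - 1)⌉ = (C : ℤ) ∧
      ⌈(n : ℚ) / ((k : ℚ) - 1)⌉ = (D : ℤ) ∧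
      (∀ c : ℕ, C ≤ c ↔ n + 1 ≤ c * (k / 2 - 1) + k) ∧ (∀ q : ℕ, D ≤ q ↔ n ≤ q * (k - 1)) := by
  have hnk : (k : ℚ) ≤ n := by exact_mod_cast hn
  have hk4 : (4 : ℚ) ≤ k := by exact_mod_cast hk
  have ht : ((k / 2 : ℕ) : ℚ) - 1 = ((k / 2 - 1 : ℕ) : ℚ) := by
    rw [Nat.cast_sub (by omega)]; simp
  have htp : (0 : ℚ) < ((k / 2 - 1 : ℕ) : ℚ) := by
    exact_mod_cast (show 0 < k / 2 - 1 by omega)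
  have hp : (k : ℚ) - 1 = ((k - 1 : ℕ) : ℚ) := by
    rw [Nat.cast_sub (by omega)]; simp
  have hpp : (0 : ℚ) < ((k - 1 : ℕ) : ℚ) := by
    exact_mod_cast (show 0 < k - 1 by omega)
  rw [ht, hp]
  have h1 : 0 ≤ ⌈((n : ℚ) - (k : ℚ) + 1) / ((k / 2 - 1 : ℕ) : ℚ)⌉ :=
    Int.ceil_nonneg (div_nonneg (by linarith) htp.le)
  have h2 : 0 ≤ ⌈(n : ℚ) / ((k - 1 : ℕ) : ℚ)⌉ := Int.ceil_nonneg (by positivity)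
  obtain ⟨C, hC⟩ := Int.eq_ofNat_of_zero_le h1
  obtain ⟨D, hD⟩ := Int.eq_ofNat_of_zero_le h2
  refine ⟨C, D, hC, hD, ?_, ?_⟩
  · intro c
    rw [← Int.ofNat_le (m := C), ← hC, Int.ceil_le, div_le_iff₀ htp]
    rw [← Nat.cast_le (α := ℚ)]
    push_cast
    constructor <;> intro h <;> linarith
  · intro q
    rw [← Int.ofNat_le (m := D), ← hD, Int.ceil_le, div_le_iff₀ hpp]
    rw [← Nat.cast_le (α := ℚ)]
    push_cast
    rfl

theorem exOP_path_formula (n k : ℕ) (hk : 4 ≤ k) (hn : k ≤ n) :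
    (exOP n (SimpleGraph.pathGraph k) : ℤ) =
      max (2 * (n : ℤ) - ⌈((n : ℚ) - (k : ℚ) + 1) / (((k / 2 : ℕ) : ℚ) - 1)⌉ - 4)
        (if n % (k - 1) = 1 then 2 * (n : ℤ) - 3 * ⌈(n : ℚ) / ((k : ℚ) - 1)⌉ + 1
         else 2 * (n : ℤ) - 3 * ⌈(n : ℚ) / ((k : ℚ) - 1)⌉) := by
  obtain ⟨C, D, hC, hD, hCi, hDi⟩ := ceil_facts n k hk hn
  rw [hC, hD]
  set s : Set ℕ := {m : ℕ | ∃ G : SimpleGraph (Fin n),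
    IsOuterplanar G ∧ ¬ ContainsCopy (SimpleGraph.pathGraph k) G ∧ m = G.edgeSet.ncard} with hs
  have hex : exOP n (SimpleGraph.pathGraph k) = sSup s := rfl
  rw [hex]
  have hp3 : 3 ≤ k - 1 := by omega
  have hup : ∀ m ∈ s, (m : ℤ) ≤ max (2 * (n : ℤ) - C - 4)
      (if n % (k - 1) = 1 then 2 * (n : ℤ) - 3 * D + 1 else 2 * (n : ℤ) - 3 * D) := by
    rintro m ⟨G, hO, hF, rfl⟩
    rcases good_upper hk G hO hF with ⟨_, c, h1, h2⟩ | ⟨q, h1, h2⟩ | ⟨q, h1, h2⟩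
    · have := (hCi c).2 h1
      refine le_max_of_le_left ?_
      omega
    · have := (hDi q).2 h1
      refine le_max_of_le_right ?_
      split_ifs <;> omega
    · have := (hDi (q + 1)).2 (by rw [add_mul]; omega)
      have hmod : n % (k - 1) = 1 := by
        rw [h1, mul_comm, Nat.mul_add_mod, Nat.mod_eq_of_lt (by omega)]
      refine le_max_of_le_right ?_
      rw [if_pos hmod]
      omega
  have hbdd : BddAbove s := by
    refine ⟨2 * n + 1, ?_⟩
    intro m hm
    have := hup m hm
    rw [le_max_iff] at this
    split_ifs at this <;> omega
  have hm1 : (mkG (R1 (k / 2 - 1) (k % 2)) n).edgeSet.ncard ∈ s :=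
    ⟨_, mkG_outer _ _ (fun a b c d => R1_outer _ _ a b c d),
      R1_free _ _ _ _ (by omega) (by omega), rfl⟩
  have hm2 : (mkG (R2 (k - 1)) n).edgeSet.ncard ∈ s :=
    ⟨_, mkG_outer _ _ (fun a b c d => R2_outer _ a b c d (by omega)),
      R2_free _ _ _ (by omega) (by omega), rfl⟩
  apply le_antisymm
  · exact hup _ (Nat.sSup_mem ⟨_, hm1⟩ hbdd)
  · have l1 := (mkG_card (R1 (k / 2 - 1) (k % 2)) n).trans (le_csSup hbdd hm1)
    have l2 := (mkG_card (R2 (k - 1)) n).trans (le_csSup hbdd hm2)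
    have c1 := R1_cnt (k / 2 - 1) (k % 2) n (by omega)
    have c2 := R2_cnt (k - 1) n hp3
    have hC' := (hCi C).1 le_rfl
    have hD' := (hDi D).1 le_rfl
    refine max_le ?_ ?_
    · have : (n - 1 - 1 - k % 2) / (k / 2 - 1) < C + 2 := by
        rw [Nat.div_lt_iff_lt_mul (by omega), add_mul]
        omega
      omega
    · have d1 : (n + (k - 1) - 1) / (k - 1) < D + 1 := by
        rw [Nat.div_lt_iff_lt_mul (by omega), add_mul]
        omega
      have d2 : (n + (k - 1) - 2) / (k - 1) < D + 1 := by
        rw [Nat.div_lt_iff_lt_mul (by omega), add_mul]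
        omega
      split_ifs with hmod
      · have d3 : (n + (k - 1) - 2) / (k - 1) < D := by
          rw [Nat.div_lt_iff_lt_mul (by omega)]
          have e := Nat.div_add_mod n (k - 1)
          rw [hmod] at e
          have hlt : n / (k - 1) < D := by
            by_contra hcon
            push Not at hcon
            have := Nat.mul_le_mul_left (k - 1) hcon
            rw [mul_comm D] at hD'
            omega
          have := Nat.mul_le_mul_left (k - 1) (Nat.succ_le_of_lt hlt)
          rw [Nat.succ_eq_add_one, mul_add] at this
          rw [mul_comm D]
          omega
        omega
      · omega
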